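/- Let F = {C_1, ..., C_{m'}} be a hitting CNF formula on a set of n variables in which C_{m'} is a largest clause, and suppose F can be extended to an unsatisfiable hitting formula G ⊇ F with m clauses on the same n variables such that every clause of G \ F has size at least |C_{m'}|. Then the number of models of F satisfies m − m' ≤ #models(F) ≤ (m − m')·2^{n − |C_{m'}|}. -/

import Mathlib

/-- A literal: a variable (natural number) with a polarity. -/
abbrev Lit : Type := ℕ × Bool

/-- Negation of a literal. -/
def Lit.neg (ℓ : Lit) : Lit := (ℓ.1, !ℓ.2)

/-- A clause: a finite set of literals. -/
abbrev Clause : Type := Finset Lit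

/-- A clause is non-tautological: it contains no literal together with its negation. -/
def Clause.NonTaut (C : Clause) : Prop := ∀ ℓ ∈ C, Lit.neg ℓ ∉ C

/-- A CNF formula: a finite set of clauses. -/
abbrev CNF : Type := Finset Clause

/-- A CNF formula is well-formed if all of its clauses are non-tautological. -/
def CNF.WellFormed (F : CNF) : Prop := ∀ C ∈ F, C.NonTaut

/-- A (total) assignment `τ` satisfies a literal. -/
def SatLit (τ : ℕ → Bool) (ℓ : Lit) : Prop := τ ℓ.1 = ℓ.2

/-- An assignment satisfies a clause if it satisfies some literal of it. -/
def SatClause (τ : ℕ → Bool) (C : Clause) : Prop := ∃ ℓ ∈ C, SatLit τ ℓ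

/-- An assignment satisfies a CNF formula if it satisfies all of its clauses. -/
def SatCNF (τ : ℕ → Bool) (F : CNF) : Prop := ∀ C ∈ F, SatClause τ C

/-- A CNF formula is unsatisfiable if no assignment satisfies it. -/
def Unsat (F : CNF) : Prop := ¬ ∃ τ : ℕ → Bool, SatCNF τ F

/-- `F` entails `G`: every model of `F` is a model of `G`. -/
def Entails (F G : CNF) : Prop := ∀ τ : ℕ → Bool, SatCNF τ F → SatCNF τ G

/-- Logical equivalence of CNF formulas. -/
def Equivalent (F G : CNF) : Prop := Entails F G ∧ Entails G F

/-- Two clauses clash: one contains a literal whose negation is in the other. -/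
def Clash (C D : Clause) : Prop := ∃ ℓ ∈ C, Lit.neg ℓ ∈ D

/-- A formula is hitting if every pair of distinct clauses clashes. -/
def Hitting (F : CNF) : Prop := ∀ C ∈ F, ∀ D ∈ F, C ≠ D → Clash C D

/-- The set of variables occurring in a CNF formula. -/
def cnfVars (F : CNF) : Finset ℕ := F.sup fun C => C.image Prod.fst

/-- A clause clashing with a falsified clause is satisfied. -/
lemma satClause_of_clash {τ : ℕ → Bool} {C D : Clause} (h : Clash C D)
    (hD : ¬ SatClause τ D) : SatClause τ C := by
  obtain ⟨ℓ, hC, hℓ⟩ := h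
  refine ⟨ℓ, hC, ?_⟩
  by_contra hne
  refine hD ⟨ℓ.neg, hℓ, ?_⟩
  simpa [SatLit, Lit.neg, Bool.eq_not] using hne

/-- The assignment falsifying a non-tautological clause that is `false` off its variables. -/
def Clause.falsifier (D : Clause) (v : ℕ) : Bool := decide ((v, false) ∈ D)

lemma Clause.NonTaut.not_satClause_falsifier {D : Clause} (hD : D.NonTaut) :
    ¬ SatClause D.falsifier D := by
  rintro ⟨⟨v, b⟩, hv, hs⟩
  have hneg := hD _ hv
  cases b <;> simp_all [SatLit, Clause.falsifier, Lit.neg]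

lemma fst_mem_of_mem_cnf {G : CNF} {V : Finset ℕ} (hG : cnfVars G ⊆ V) {D : Clause}
    (hD : D ∈ G) : D.image Prod.fst ⊆ V :=
  (Finset.le_sup (f := fun C : Clause => C.image Prod.fst) hD).trans hG

lemma Clause.NonTaut.card_image_fst {D : Clause} (hD : D.NonTaut) :
    (D.image Prod.fst).card = D.card := by
  refine Finset.card_image_of_injOn ?_
  rintro ⟨v, b⟩ hv ⟨w, c⟩ hw (rfl : v = w)
  have hneg := hD _ hv
  cases b <;> cases c <;> simp_all [Lit.neg]

/-- Assignments of `V` are determined by the variables of `V` they make true. -/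
lemma injOn_filter_true (V : Finset ℕ) :
    Set.InjOn (fun τ : ℕ → Bool => V.filter (fun v => τ v = true))
      {τ | ∀ v ∉ V, τ v = false} := by
  intro τ hτ σ hσ h
  funext v
  by_cases hv : v ∈ V
  · have := Finset.ext_iff.mp h v
    simpa [hv] using this
  · rw [hτ v hv, hσ v hv]

lemma finite_assignments (V : Finset ℕ) : {τ : ℕ → Bool | ∀ v ∉ V, τ v = false}.Finite :=
  Set.Finite.of_injOn (t := (V.powerset : Set (Finset ℕ)))
    (fun _ _ => Finset.mem_coe.mpr (Finset.mem_powerset.mpr (Finset.filter_subset _ _)))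
    (injOn_filter_true V) (Finset.finite_toSet _)

/-- A clause `D` over `V` is falsified by at most `2 ^ (|V| - |D|)` assignments of `V`. -/
lemma Clause.NonTaut.ncard_falsifying_le {D : Clause} (hD : D.NonTaut) {V : Finset ℕ}
    (hV : D.image Prod.fst ⊆ V) :
    {τ : ℕ → Bool | (∀ v ∉ V, τ v = false) ∧ ¬ SatClause τ D}.ncard ≤
      2 ^ (V.card - D.card) := by
  rw [← hD.card_image_fst, ← Finset.card_sdiff_of_subset hV, ← Finset.card_powerset,
    ← Set.ncard_coe_finset]
  refine Set.ncard_le_ncard_of_injOn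
    (fun τ : ℕ → Bool => (V \ D.image Prod.fst).filter (fun v => τ v = true))
    (fun _ _ => Finset.mem_coe.mpr (Finset.mem_powerset.mpr (Finset.filter_subset _ _)))
    ?_ (Finset.finite_toSet _)
  rintro τ ⟨hτ, hτD⟩ σ ⟨hσ, hσD⟩ h
  funext v
  by_cases hv : v ∈ V
  · by_cases hvD : v ∈ D.image Prod.fst
    · obtain ⟨⟨w, b⟩, hw, rfl⟩ := Finset.mem_image.mp hvD
      have h₁ : τ w ≠ b := fun h => hτD ⟨_, hw, h⟩
      have h₂ : σ w ≠ b := fun h => hσD ⟨_, hw, h⟩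
      exact (Bool.eq_not.mpr h₁).trans (Bool.eq_not.mpr h₂).symm
    · have := Finset.ext_iff.mp h v
      simp only [Finset.mem_filter, Finset.mem_sdiff, hv, hvD, not_false_eq_true, and_self,
        true_and] at this
      exact Bool.eq_iff_iff.mpr this
  · rw [hτ v hv, hσ v hv]

/-- let `F` be a hitting formula on the `n`-element variable set `V` in
which `Cmax` is a largest clause, extendable to an unsatisfiable hitting formula
`G ⊇ F` on the same variables all of whose new clauses have size at least `|Cmax|`.
Then `|G| − |F| ≤ #models(F) ≤ (|G| − |F|) · 2^(n − |Cmax|)`, where models of `F` are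
total assignments of `V` (encoded as functions `ℕ → Bool` that are `false` off `V`). -/
theorem generation_pruning_bounds (F G : CNF) (V : Finset ℕ) (n : ℕ) (Cmax : Clause)
    (hwfF : F.WellFormed) (hwfG : G.WellFormed)
    (hhitF : Hitting F) (hhitG : Hitting G) (hFG : F ⊆ G) (hGunsat : Unsat G)
    (hvarsF : cnfVars F ⊆ V) (hvarsG : cnfVars G ⊆ V) (hV : V.card = n)
    (hCmax : Cmax ∈ F) (hmax : ∀ D ∈ F, D.card ≤ Cmax.card)
    (hbig : ∀ D ∈ G, D ∉ F → Cmax.card ≤ D.card) :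
    G.card - F.card ≤
        Nat.card {τ : ℕ → Bool // (∀ v ∉ V, τ v = false) ∧ SatCNF τ F} ∧
      Nat.card {τ : ℕ → Bool // (∀ v ∉ V, τ v = false) ∧ SatCNF τ F} ≤
        (G.card - F.card) * 2 ^ (n - Cmax.card) := by
  rw [← Finset.card_sdiff_of_subset hFG]
  set M : Set (ℕ → Bool) := {τ | (∀ v ∉ V, τ v = false) ∧ SatCNF τ F}
  change (G \ F).card ≤ M.ncard ∧ M.ncard ≤ _
  have hfin : M.Finite := (finite_assignments V).subset fun τ h => h.1
  constructor
  · rw [← Set.ncard_coe_finset]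
    refine Set.ncard_le_ncard_of_injOn Clause.falsifier ?_ ?_ hfin
    · intro D hD
      obtain ⟨hDG, hDF⟩ := Finset.mem_sdiff.mp hD
      refine ⟨fun v hv => ?_, fun C hC => ?_⟩
      · exact decide_eq_false fun h =>
          hv (fst_mem_of_mem_cnf hvarsG hDG (Finset.mem_image_of_mem Prod.fst h))
      · exact satClause_of_clash (hhitG C (hFG hC) D hDG (by rintro rfl; exact hDF hC))
          (hwfG D hDG).not_satClause_falsifier
    · intro D hD E hE h
      have hDG := (Finset.mem_sdiff.mp hD).1
      have hEG := (Finset.mem_sdiff.mp hE).1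
      by_contra hne
      refine (hwfG E hEG).not_satClause_falsifier ?_
      rw [← h]
      exact satClause_of_clash (hhitG E hEG D hDG (Ne.symm hne))
        (hwfG D hDG).not_satClause_falsifier
  · have hfinD (D : Clause) :
        {τ : ℕ → Bool | (∀ v ∉ V, τ v = false) ∧ ¬ SatClause τ D}.Finite :=
      (finite_assignments V).subset fun τ h => h.1
    have hsub : M ⊆ ⋃ D ∈ G \ F,
        {τ : ℕ → Bool | (∀ v ∉ V, τ v = false) ∧ ¬ SatClause τ D} := by
      rintro τ ⟨hτ, hτF⟩
      obtain ⟨D, hDG, hD⟩ : ∃ D ∈ G, ¬ SatClause τ D := by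
        by_contra! h
        exact hGunsat ⟨τ, h⟩
      exact Set.mem_biUnion (Finset.mem_sdiff.mpr ⟨hDG, fun hDF => hD (hτF D hDF)⟩) ⟨hτ, hD⟩
    calc M.ncard ≤ _ := Set.ncard_le_ncard hsub
          ((G \ F).finite_toSet.biUnion fun D _ => hfinD D)
      _ ≤ ∑ D ∈ G \ F, {τ : ℕ → Bool | (∀ v ∉ V, τ v = false) ∧ ¬ SatClause τ D}.ncard :=
        Finset.set_ncard_biUnion_le _ _
      _ ≤ (G \ F).card * 2 ^ (n - Cmax.card) := by
        rw [← smul_eq_mul]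
        refine Finset.sum_le_card_nsmul _ _ _ fun D hD => ?_
        obtain ⟨hDG, hDF⟩ := Finset.mem_sdiff.mp hD
        refine ((hwfG D hDG).ncard_falsifying_le (fst_mem_of_mem_cnf hvarsG hDG)).trans ?_
        rw [hV]
        exact Nat.pow_le_pow_right two_pos (Nat.sub_le_sub_left (hbig D hDG hDF) n)
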